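/- Define Φ_m = B((t_m+2t_{m-1}+t_{m-2}−3)/2) − B((t_m+t_{m-2}−3)/2) for m≥4. Then for every m≥7, Φ_m = Φ_{m-1} + Φ_{m-2} + Φ_{m-3} + (−3t_m+6t_{m-1}+t_{m-2}−1)/2. -/

import Mathlib

/-- The three-letter alphabet of the Tribonacci word. -/
inductive TLetter : Type
  | a | b | c
deriving DecidableEq

/-- The Tribonacci substitution σ(a)=ab, σ(b)=ac, σ(c)=a. -/
def tsubst : TLetter → List TLetter
  | .a => [.a, .b]
  | .b => [.a, .c]
  | .c => [.a]

/-- `Tword m = σ^m(a)`, the m-th finite Tribonacci word. -/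
def Tword : ℕ → List TLetter
  | 0 => [.a]
  | n + 1 => (Tword n).flatMap tsubst

/-- The prefix 𝕋[1,n] of the Tribonacci word of length n
(each `Tword n` is a prefix of the next and has length ≥ n). -/
def TPrefix (n : ℕ) : List TLetter := (Tword n).take n

/-- A word is a factor of the Tribonacci word 𝕋. -/
def IsFactorT (w : List TLetter) : Prop := ∃ m, w <:+: Tword m

/-- `tribAux i = t_{i-2}`: Tribonacci numbers, shifted so that the index is a natural. -/
def tribAux : ℕ → ℕ
  | 0 => 0
  | 1 => 1
  | 2 => 1
  | n + 3 => tribAux (n + 2) + tribAux (n + 1) + tribAux n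

/-- The Tribonacci numbers `t m` for `m : ℤ`: t₋₂=0, t₋₁=1, t₀=1,
`t m = t (m-1) + t (m-2) + t (m-3)` for m ≥ 1. (Junk value 0 below -2.) -/
def t (m : ℤ) : ℕ := tribAux (m + 2).toNat

/-- Kernel numbers: k₀=0, k₁=k₂=1, `k m = k (m-1) + k (m-2) + k (m-3) - 1` for m ≥ 3. -/
def kAux : ℕ → ℕ
  | 0 => 0
  | 1 => 1
  | 2 => 1
  | n + 3 => kAux (n + 2) + kAux (n + 1) + kAux n - 1

def kker (m : ℤ) : ℕ := kAux m.toNat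

/-- `A n`: the number of distinct nonempty words w with ww a factor of 𝕋[1,n]. -/
noncomputable def A (n : ℕ) : ℕ := Nat.card {w : List TLetter // w ≠ [] ∧ (w ++ w) <:+: TPrefix n}

/-- `B n`: the number of occurrences of squares in 𝕋[1,n], i.e. of pairs (w,i) with
w nonempty, i ≥ 1, ww occurring in 𝕋 at position i and i + 2|w| - 1 ≤ n. -/
noncomputable def B (n : ℕ) : ℕ :=
  Nat.card {p : List TLetter × ℕ // p.1 ≠ [] ∧ 1 ≤ p.2 ∧
    p.2 + 2 * p.1.length - 1 ≤ n ∧ (p.1 ++ p.1) <+: (TPrefix n).drop (p.2 - 1)}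

/-- `C n`: the number of distinct nonempty words w with www a factor of 𝕋[1,n]. -/
noncomputable def C (n : ℕ) : ℕ := Nat.card {w : List TLetter // w ≠ [] ∧ (w ++ w ++ w) <:+: TPrefix n}

/-- `D n`: the number of occurrences of cubes in 𝕋[1,n], i.e. of pairs (w,i) with
w nonempty, i ≥ 1, www occurring in 𝕋 at position i and i + 3|w| - 1 ≤ n. -/
noncomputable def D (n : ℕ) : ℕ :=
  Nat.card {p : List TLetter × ℕ // p.1 ≠ [] ∧ 1 ≤ p.2 ∧
    p.2 + 3 * p.1.length - 1 ≤ n ∧ (p.1 ++ p.1 ++ p.1) <+: (TPrefix n).drop (p.2 - 1)}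

/-- Φ_m = B((t_m+2t_{m-1}+t_{m-2}-3)/2) - B((t_m+t_{m-2}-3)/2). -/
noncomputable def Phi (m : ℤ) : ℚ :=
  (B ((t m + 2 * t (m - 1) + t (m - 2) - 3) / 2) : ℚ) - (B ((t m + t (m - 2) - 3) / 2) : ℚ)


namespace TribonacciWord

open Finset

/-! ### The infinite word and its substitution structure -/

theorem flatMap_prefix {α β : Type*} {l₁ l₂ : List α} (f : α → List β) (h : l₁ <+: l₂) :
    l₁.flatMap f <+: l₂.flatMap f := by
  obtain ⟨s, rfl⟩ := h
  simp

theorem Tword_prefix_succ (n : ℕ) : Tword n <+: Tword (n + 1) := by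
  induction n with
  | zero => exact ⟨[.b], rfl⟩
  | succ n ih => exact flatMap_prefix tsubst ih

theorem Tword_prefix {m n : ℕ} (h : m ≤ n) : Tword m <+: Tword n := by
  induction n, h using Nat.le_induction with
  | base => exact List.prefix_rfl
  | succ n _ ih => exact ih.trans (Tword_prefix_succ n)

theorem length_le_length_flatMap (l : List TLetter) : l.length ≤ (l.flatMap tsubst).length := by
  induction l with
  | nil => simp
  | cons x l ih =>
    simp only [List.flatMap_cons, List.length_append, List.length_cons]
    have : 1 ≤ (tsubst x).length := by cases x <;> simp [tsubst]
    omega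

theorem lt_length_Tword (n : ℕ) : n < (Tword n).length := by
  induction n with
  | zero => simp [Tword]
  | succ n ih =>
    obtain ⟨s, hs⟩ := Tword_prefix (Nat.zero_le n)
    have h := length_le_length_flatMap s
    simp only [Tword] at hs ⊢
    rw [← hs] at ih ⊢
    simp [tsubst] at ih h ⊢
    omega

/-- The `n`-th letter (counted from `0`) of the Tribonacci word. -/
def letter (n : ℕ) : TLetter := (Tword n).getD n .a

theorem letter_eq_getElem {m i : ℕ} (h : i < (Tword m).length) : letter i = (Tword m)[i] := by
  have hi := lt_length_Tword i
  rw [letter, List.getD_eq_getElem _ _ hi]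
  rcases le_total i m with h' | h'
  · exact (Tword_prefix h').getElem hi
  · exact ((Tword_prefix h').getElem h).symm

theorem take_Tword {m n : ℕ} (h : n ≤ (Tword m).length) :
    (Tword m).take n = (List.range n).map letter := by
  apply List.ext_getElem
  · simpa using h
  · intro i h₁ h₂
    simp only [List.length_take, lt_inf_iff] at h₁
    simp [letter_eq_getElem h₁.2]

theorem TPrefix_eq (n : ℕ) : TPrefix n = (List.range n).map letter :=
  take_Tword (lt_length_Tword n).le

/-- The length of the image under the substitution of the prefix of length `n`. -/
def S (n : ℕ) : ℕ := (((List.range n).map letter).flatMap tsubst).length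

theorem S_zero : S 0 = 0 := rfl

theorem S_succ (n : ℕ) : S (n + 1) = S n + (tsubst (letter n)).length := by
  simp [S, List.range_succ]

theorem flatMap_map_range (n : ℕ) :
    ((List.range n).map letter).flatMap tsubst = (List.range (S n)).map letter := by
  have h : ((List.range n).map letter).flatMap tsubst <+: Tword (n + 1) := by
    rw [← TPrefix_eq]
    exact flatMap_prefix tsubst (List.take_prefix n (Tword n))
  rw [← take_Tword (m := n + 1) (n := S n) h.length_le]
  exact List.prefix_iff_eq_take.1 h

theorem tsubst_letter (n : ℕ) :
    tsubst (letter n) = (List.range (tsubst (letter n)).length).map (fun i => letter (S n + i)) := by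
  have h := flatMap_map_range (n + 1)
  rw [List.range_succ, List.map_append, List.flatMap_append, flatMap_map_range, S_succ,
    List.range_add, List.map_append] at h
  simpa [Function.comp_def] using List.append_cancel_left h

/-- The second letter of `σ(x)a`, which is also tied to the last letter of `σ(x)`. -/
def cyc : TLetter → TLetter
  | .a => .b
  | .b => .c
  | .c => .a

theorem cyc_injective : Function.Injective cyc := by
  intro x y h
  cases x <;> cases y <;> simp_all [cyc]

theorem letter_S (n : ℕ) : letter (S n) = .a := by
  have h := tsubst_letter n
  cases hn : letter n <;> rw [hn] at h <;> simp [tsubst, List.range_succ] at h <;> simp [h]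

theorem S_succ_of_eq {n : ℕ} (h : letter n = .c) : S (n + 1) = S n + 1 := by
  rw [S_succ, h]; rfl

theorem S_succ_of_ne {n : ℕ} (h : letter n ≠ .c) : S (n + 1) = S n + 2 := by
  rw [S_succ]
  cases hn : letter n <;> simp_all [tsubst]

theorem letter_S_add_one (n : ℕ) : letter (S n + 1) = cyc (letter n) := by
  have h := tsubst_letter n
  cases hn : letter n
  · rw [hn] at h; simp [tsubst, List.range_succ] at h; simp [cyc, h]
  · rw [hn] at h; simp [tsubst, List.range_succ] at h; simp [cyc, h]
  · rw [← S_succ_of_eq hn, letter_S]; rfl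

theorem S_strictMono : StrictMono S := by
  refine strictMono_nat_of_lt_succ fun n => ?_
  by_cases h : letter n = .c
  · rw [S_succ_of_eq h]; omega
  · rw [S_succ_of_ne h]; omega

theorem letter_of_succ_eq_S {i j : ℕ} (h : i + 1 = S (j + 1)) : letter i = cyc (letter j) := by
  by_cases hj : letter j = .c
  · rw [S_succ_of_eq hj] at h
    rw [show i = S j by omega, letter_S, hj]; rfl
  · rw [S_succ_of_ne hj] at h
    rw [show i = S j + 1 by omega, letter_S_add_one]

theorem eq_S_or_eq_S_add_one (x : ℕ) :
    (∃ y, x = S y) ∨ ∃ y, x = S y + 1 ∧ letter y ≠ .c := by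
  induction x with
  | zero => exact .inl ⟨0, rfl⟩
  | succ x ih =>
    rcases ih with ⟨y, rfl⟩ | ⟨y, rfl, hy⟩
    · by_cases hy : letter y = .c
      · exact .inl ⟨y + 1, (S_succ_of_eq hy).symm⟩
      · exact .inr ⟨y, rfl, hy⟩
    · exact .inl ⟨y + 1, (S_succ_of_ne hy).symm⟩

theorem cyc_ne_a {x : TLetter} (h : x ≠ .c) : cyc x ≠ .a := by
  cases x <;> simp_all [cyc]

theorem exists_of_eq_a {x : ℕ} (h : letter x = .a) : ∃ y, x = S y := by
  rcases eq_S_or_eq_S_add_one x with h' | ⟨y, rfl, hy⟩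
  · exact h'
  · rw [letter_S_add_one] at h
    exact absurd h (cyc_ne_a hy)

theorem exists_of_ne_a {x : ℕ} (h : letter x ≠ .a) : ∃ y, x = S y + 1 ∧ letter y ≠ .c := by
  rcases eq_S_or_eq_S_add_one x with ⟨y, rfl⟩ | h'
  · exact absurd (letter_S y) h
  · exact h'

theorem letter_succ_of_ne_a {x : ℕ} (h : letter x ≠ .a) : letter (x + 1) = .a := by
  obtain ⟨y, rfl, hy⟩ := exists_of_ne_a h
  rw [show S y + 1 + 1 = S (y + 1) by rw [S_succ_of_ne hy], letter_S]

theorem letter_of_succ_ne_a {x : ℕ} (h : letter (x + 1) ≠ .a) : letter x = .a := by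
  by_contra h'
  exact h (letter_succ_of_ne_a h')

theorem letter_zero : letter 0 = .a := letter_S 0

theorem not_three_a {x : ℕ} (h₀ : letter x = .a) (h₁ : letter (x + 1) = .a) :
    letter (x + 2) ≠ .a := by
  obtain ⟨y, rfl⟩ := exists_of_eq_a h₀
  rw [letter_S_add_one] at h₁
  have hy : letter y = .c := by
    by_contra h
    exact cyc_ne_a h h₁
  have hy' : letter (y + 1) = .a := letter_succ_of_ne_a (by rw [hy]; decide)
  rw [show S y + 2 = S (y + 1) + 1 by rw [S_succ_of_eq hy], letter_S_add_one, hy']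
  decide

/-! ### Agreement of factors -/

/-- The factors of length `n` at positions `j` and `k` coincide. -/
def Agree (j k n : ℕ) : Prop := ∀ i < n, letter (j + i) = letter (k + i)

theorem Agree.mono {j k n m : ℕ} (h : Agree j k n) (hm : m ≤ n) : Agree j k m :=
  fun i hi => h i (by omega)

theorem agree_succ {j k n : ℕ} :
    Agree j k (n + 1) ↔ Agree j k n ∧ letter (j + n) = letter (k + n) := by
  refine ⟨fun h => ⟨h.mono (by omega), h n (by omega)⟩, fun h i hi => ?_⟩
  rcases Nat.lt_succ_iff_lt_or_eq.1 hi with hi | rfl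
  · exact h.1 i hi
  · exact h.2

theorem Agree.S_add {j k n : ℕ} (h : Agree j k n) : S (j + n) + S k = S (k + n) + S j := by
  induction n with
  | zero => simp [add_comm]
  | succ n ih =>
    have h' := agree_succ.1 h
    have := ih h'.1
    rw [← add_assoc, ← add_assoc, S_succ, S_succ, h'.2]
    omega

theorem agree_S_iff {j k n l : ℕ} (hl : S j + l = S (j + n)) :
    Agree (S j) (S k) (l + 1) ↔ Agree j k n := by
  induction n generalizing l with
  | zero =>
    have : l = 0 := by simpa using hl
    subst this
    simp [Agree, letter_S]
  | succ n ih =>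
    have hmono : S (j + n) < S (j + (n + 1)) := S_strictMono (by omega)
    have hjn : S j ≤ S (j + n) := S_strictMono.monotone (by omega)
    obtain ⟨m, hm⟩ := Nat.exists_eq_add_of_le hjn
    have ih' := ih (l := m) hm.symm
    constructor
    · intro h
      have h₁ := ih'.1 (h.mono (by omega))
      have h₂ := h₁.S_add
      have h₃ := h (m + 1) (by omega)
      rw [← add_assoc, ← add_assoc, ← hm, show S k + m = S (k + n) by omega,
        letter_S_add_one, letter_S_add_one] at h₃
      exact agree_succ.2 ⟨h₁, cyc_injective h₃⟩
    · intro h i hi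
      have h₁ := agree_succ.1 h
      have h₂ := h₁.1.S_add
      have h₃ := h.S_add
      have hle : S (j + (n + 1)) ≤ S (j + n) + 2 := by
        rw [← add_assoc]
        by_cases hc : letter (j + n) = .c
        · rw [S_succ_of_eq hc]; omega
        · rw [S_succ_of_ne hc]
      rcases (by omega : i < m + 1 ∨ i = m + 1 ∨ i = l) with hi | rfl | rfl
      · exact ih'.2 h₁.1 i hi
      · rw [← add_assoc, ← add_assoc, ← hm, show S k + m = S (k + n) by omega,
          letter_S_add_one, letter_S_add_one, h₁.2]
      · rw [hl, show S k + i = S (k + (n + 1)) by omega, letter_S, letter_S]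

/-! ### Squares by their end and middle positions -/

/-- Middle positions of the squares ending just before position `e`. -/
def squares (e : ℕ) : Set ℕ := {k | ∃ j p, 0 < p ∧ j + p = k ∧ k + p = e ∧ Agree j k p}

/-- Squares ending before `e` whose period extends through position `e`. -/
def extending (e : ℕ) : Set ℕ := {k | ∃ j p, 0 < p ∧ j + p = k ∧ k + p = e ∧ Agree j k (p + 1)}

/-- Squares ending before `e` whose period does not extend to the left. -/
def starting (e : ℕ) : Set ℕ :=
  {k | ∃ j p, 0 < p ∧ j + p = k ∧ k + p = e ∧ Agree j k p ∧
    ∀ i, i + 1 = j → letter i ≠ letter (i + p)}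

/-- Middle positions of the factors `wxw` ending before `e` that are maximal repetitions. -/
def gapped (x : TLetter) (e : ℕ) : Set ℕ :=
  {q | ∃ j p, j + p = q ∧ q + p + 1 = e ∧ letter q = x ∧ letter e ≠ x ∧ Agree j (q + 1) p ∧
    ∀ i, i + 1 = j → letter i ≠ x}

theorem squares_finite (e : ℕ) : (squares e).Finite :=
  (Set.finite_Iio e).subset (by rintro k ⟨j, p, hp, h₁, h₂, -⟩; simp only [Set.mem_Iio]; omega)

theorem squares_zero : squares 0 = ∅ := by
  ext k
  simp only [squares, Set.mem_ofPred_eq, Set.mem_empty_iff_false, iff_false]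
  rintro ⟨j, p, hp, h₁, h₂, -⟩
  omega

theorem starting_zero : starting 0 = ∅ := by
  ext k
  simp only [starting, Set.mem_ofPred_eq, Set.mem_empty_iff_false, iff_false]
  rintro ⟨j, p, hp, h₁, h₂, -⟩
  omega

theorem gapped_zero (x : TLetter) : gapped x 0 = ∅ := by
  ext k
  simp only [gapped, Set.mem_ofPred_eq, Set.mem_empty_iff_false, iff_false]
  rintro ⟨j, p, h₁, h₂, -⟩
  omega

theorem gapped_of_eq {x : TLetter} {e : ℕ} (h : letter e = x) : gapped x e = ∅ := by
  ext k
  simp only [gapped, Set.mem_ofPred_eq, Set.mem_empty_iff_false, iff_false]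
  rintro ⟨j, p, -, -, -, h', -⟩
  exact h' h

theorem ncard_squares_succ (e : ℕ) :
    (squares (e + 1)).ncard = (extending e).ncard + (starting (e + 1)).ncard := by
  have h : squares (e + 1) = Nat.succ '' extending e ∪ starting (e + 1) := by
    ext k
    constructor
    · rintro ⟨j, p, hp, rfl, he, h⟩
      by_cases hj : ∃ i, i + 1 = j ∧ letter i = letter (i + p)
      · obtain ⟨i, rfl, hi⟩ := hj
        refine .inl ⟨i + p, ⟨i, p, hp, rfl, by omega, ?_⟩, by simp; omega⟩
        intro m hm
        cases m with
        | zero => exact hi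
        | succ m =>
          have := h m (by omega)
          rwa [show i + 1 + m = i + (m + 1) by omega,
            show i + 1 + p + m = i + p + (m + 1) by omega] at this
      · push Not at hj
        exact .inr ⟨j, p, hp, rfl, he, h, hj⟩
    · rintro (⟨k, ⟨j, p, hp, rfl, he, h⟩, rfl⟩ | ⟨j, p, hp, hk, he, h, -⟩)
      · refine ⟨j + 1, p, hp, by simp; omega, by simp; omega, fun m hm => ?_⟩
        have := h (m + 1) (by omega)
        rwa [show j + 1 + m = j + (m + 1) by omega,
          show (j + p).succ + m = j + p + (m + 1) by simp; omega]
      · exact ⟨j, p, hp, hk, he, h⟩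
  have hfin := squares_finite (e + 1)
  have hd : Disjoint (Nat.succ '' extending e) (starting (e + 1)) := by
    rw [Set.disjoint_left]
    rintro _ ⟨k, ⟨j, p, hp, rfl, he, h⟩, rfl⟩ ⟨j', p', hp', hk', he', -, h'⟩
    simp only [Nat.succ_eq_add_one] at hk' he'
    obtain rfl : p' = p := by omega
    exact h' j (by omega) (by simpa using h 0 (by omega))
  rw [h] at hfin ⊢
  rw [Set.ncard_union_eq hd (hfin.subset Set.subset_union_left)
    (hfin.subset Set.subset_union_right), Set.ncard_image_of_injective _ Nat.succ_injective]

theorem extending_S (e : ℕ) : extending (S e) = S '' squares e := by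
  ext k
  constructor
  · rintro ⟨j, p, hp, hk, he, h⟩
    have hka : letter k = .a := by
      have := h p (by omega)
      rwa [hk, he, letter_S] at this
    have hja : letter j = .a := by
      have := h 0 (by omega)
      simpa [hka] using this
    obtain ⟨j, rfl⟩ := exists_of_eq_a hja
    obtain ⟨k, rfl⟩ := exists_of_eq_a hka
    have hjk : j < k := S_strictMono.lt_iff_lt.1 (by omega)
    obtain ⟨q, rfl⟩ := Nat.exists_eq_add_of_le hjk.le
    have h' := (agree_S_iff hk).1 h
    have hs := h'.S_add
    exact ⟨_, ⟨j, q, by omega, rfl, S_strictMono.injective (by omega), h'⟩, rfl⟩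
  · rintro ⟨k, ⟨j, p, hp, rfl, rfl, h⟩, rfl⟩
    have hjk : S j < S (j + p) := S_strictMono (by omega)
    obtain ⟨q, hq⟩ := Nat.exists_eq_add_of_le hjk.le
    have hs := h.S_add
    exact ⟨S j, q, by omega, hq.symm, by omega, (agree_S_iff hq.symm).2 h⟩

theorem extending_S_add_one {e : ℕ} (hec : letter e ≠ .c) :
    extending (S e + 1) = (fun k => S k + 1) '' extending e := by
  ext k
  constructor
  · rintro ⟨j, p, hp, hk, he, h⟩
    have hke : letter k = cyc (letter e) := by
      have := h p (by omega)
      rwa [hk, he, letter_S_add_one] at this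
    have hje : letter j = cyc (letter e) := by
      have := h 0 (by omega)
      simpa [hke] using this
    obtain ⟨j, rfl, hjc⟩ := exists_of_ne_a (hje ▸ cyc_ne_a hec)
    obtain ⟨k, rfl, hkc⟩ := exists_of_ne_a (hke ▸ cyc_ne_a hec)
    rw [letter_S_add_one] at hke hje
    have hjk : j < k := S_strictMono.lt_iff_lt.1 (by omega)
    obtain ⟨q, rfl⟩ := Nat.exists_eq_add_of_le hjk.le
    have hS : Agree (S j) (S (j + q)) (p + 1) := by
      intro i hi
      cases i with
      | zero => simp [letter_S]
      | succ i =>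
        have := h i (by omega)
        rwa [add_right_comm, add_right_comm _ 1 i] at this
    have h' := (agree_S_iff (by omega : S j + p = S (j + q))).1 hS
    have hs := h'.S_add
    obtain rfl : j + q + q = e := S_strictMono.injective (by omega)
    exact ⟨_, ⟨j, q, by omega, rfl, rfl, agree_succ.2 ⟨h', cyc_injective hke⟩⟩, rfl⟩
  · rintro ⟨k, ⟨j, p, hp, rfl, rfl, h⟩, rfl⟩
    have hjk : S j < S (j + p) := S_strictMono (by omega)
    obtain ⟨q, hq⟩ := Nat.exists_eq_add_of_le hjk.le
    have h₁ := agree_succ.1 h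
    have hs := h₁.1.S_add
    refine ⟨S j + 1, q, by omega, by simp only; omega, by simp only; omega, fun i hi => ?_⟩
    have hS := (agree_S_iff hq.symm).2 h₁.1
    rcases Nat.lt_succ_iff_lt_or_eq.1 hi with hi | rfl
    · have := hS (i + 1) (by omega)
      simpa only [add_assoc, add_comm 1 i] using this
    · simp only
      rw [show S j + 1 + i = S (j + p) + 1 by omega,
        show S (j + p) + 1 + i = S (j + p + p) + 1 by omega, letter_S_add_one, letter_S_add_one,
        h₁.2]

theorem letter_eq_a_of_starting {j p : ℕ} (hp : 0 < p) (h : Agree j (j + p) p)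
    (h' : ∀ i, i + 1 = j → letter i ≠ letter (i + p)) :
    letter j = .a ∧ letter (j + p) = .a := by
  have h₀ : letter j = letter (j + p) := by simpa using h 0 hp
  refine (and_iff_left_of_imp fun h => h₀ ▸ h).2 ?_
  by_contra hj
  cases j with
  | zero => exact hj letter_zero
  | succ i =>
    refine h' i rfl ?_
    rw [letter_of_succ_ne_a hj]
    rw [h₀, add_right_comm] at hj
    rw [letter_of_succ_ne_a hj]

theorem starting_S (e : ℕ) : starting (S e) = S '' starting e := by
  ext k
  constructor
  · rintro ⟨j, p, hp, rfl, he, h, hl⟩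
    obtain ⟨hja, hka⟩ := letter_eq_a_of_starting hp h hl
    obtain ⟨j, rfl⟩ := exists_of_eq_a hja
    obtain ⟨k, hk⟩ := exists_of_eq_a hka
    have hjk : j < k := S_strictMono.lt_iff_lt.1 (by omega)
    obtain ⟨q, rfl⟩ := Nat.exists_eq_add_of_le hjk.le
    have h₁ : Agree (S j) (S (j + q)) (p + 1) := by
      rw [← hk]
      exact agree_succ.2 ⟨h, by rw [he, letter_S, hka]⟩
    have h' := (agree_S_iff hk).1 h₁
    have hs := h'.S_add
    refine ⟨_, ⟨j, q, by omega, rfl, S_strictMono.injective (by omega), h', ?_⟩, hk.symm⟩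
    rintro i rfl heq
    have hi : 0 < S (i + 1) := S_strictMono.lt_iff_lt.2 (Nat.succ_pos i)
    obtain ⟨m, hm⟩ := Nat.exists_eq_add_of_le' hi
    refine hl m (by omega) ?_
    rw [letter_of_succ_eq_S hm.symm, letter_of_succ_eq_S (j := i + q) (i := m + p), heq]
    rw [add_right_comm i, ← hk]; omega
  · rintro ⟨k, ⟨j, p, hp, rfl, rfl, h, hl⟩, rfl⟩
    have hjk : S j < S (j + p) := S_strictMono (by omega)
    obtain ⟨q, hq⟩ := Nat.exists_eq_add_of_le hjk.le
    have hs := h.S_add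
    refine ⟨S j, q, by omega, hq.symm, by omega,
      ((agree_S_iff hq.symm).2 h).mono (by omega), fun m hm heq => ?_⟩
    cases j with
    | zero => simp [S_zero] at hm
    | succ i =>
      refine hl i rfl (cyc_injective ?_)
      rw [← letter_of_succ_eq_S hm, heq]
      apply letter_of_succ_eq_S
      rw [add_right_comm i p, hq]; omega

theorem starting_S_add_one {e : ℕ} (hec : letter e ≠ .c) :
    starting (S e + 1) = (fun q => S (q + 1)) '' gapped .c e := by
  ext k
  constructor
  · rintro ⟨j, p, hp, rfl, he, h, hl⟩
    obtain ⟨hja, hka⟩ := letter_eq_a_of_starting hp h hl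
    obtain ⟨j, rfl⟩ := exists_of_eq_a hja
    obtain ⟨k, hk⟩ := exists_of_eq_a hka
    have hjk : j < k := S_strictMono.lt_iff_lt.1 (by omega)
    have hke : k ≤ e := S_strictMono.le_iff_le.1 (by omega)
    obtain ⟨q, rfl⟩ := Nat.exists_eq_add_of_le hke
    have hsym : Agree (S k) (S j) (p - 1 + 1) := by
      rw [← hk, Nat.sub_add_cancel hp]
      exact fun i hi => (h i hi).symm
    have h' := (agree_S_iff (n := q) (by omega)).1 hsym
    have hs := h'.S_add
    have hjq : S (j + q) + 1 = S k := by omega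
    have hlt : j + q < k := S_strictMono.lt_iff_lt.1 (by omega)
    have hc : letter (j + q) = .c := by
      by_contra hc
      have := S_succ_of_ne hc
      have : S (j + q + 1) ≤ S k := S_strictMono.monotone hlt
      omega
    obtain rfl : j + q + 1 = k := S_strictMono.injective (by rw [S_succ_of_eq hc]; omega)
    refine ⟨j + q, ⟨j, q, rfl, by omega, hc, hec, fun i hi => (h' i hi).symm, ?_⟩, hk.symm⟩
    rintro i rfl hi
    have hpos : 0 < S (i + 1) := S_strictMono.lt_iff_lt.2 (Nat.succ_pos i)
    obtain ⟨m, hm⟩ := Nat.exists_eq_add_of_le' hpos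
    refine hl m (by omega) ?_
    rw [letter_of_succ_eq_S hm.symm, letter_of_succ_eq_S (j := i + 1 + q) (i := m + p), hc, hi]
    omega
  · rintro ⟨q, ⟨j, p, rfl, rfl, hc, -, h, hl⟩, rfl⟩
    have hjk : S j < S (j + p + 1) := S_strictMono (by omega)
    have hjk' : S j ≤ S (j + p) := S_strictMono.monotone (by omega)
    obtain ⟨q, hq⟩ := Nat.exists_eq_add_of_le hjk'
    have hs := h.S_add
    have hc' := S_succ_of_eq hc
    rw [add_right_comm _ 1 p] at hs
    refine ⟨S j, q + 1, by omega, by simp only; omega, by simp only; omega,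
      (agree_S_iff hq.symm).2 h, fun m hm heq => ?_⟩
    cases j with
    | zero => simp [S_zero] at hm
    | succ i =>
      refine hl i rfl (cyc_injective ?_)
      rw [← letter_of_succ_eq_S hm, heq, ← hc]
      apply letter_of_succ_eq_S
      omega

theorem gapped_cyc_S_add_one {x : TLetter} (hx : x ≠ .c) (y : ℕ) :
    gapped (cyc x) (S y + 1) = (fun q => S q + 1) '' gapped x y := by
  have hxa := cyc_ne_a hx
  ext q
  constructor
  · rintro ⟨j, p, rfl, he, hq, hy, h, hl⟩
    obtain ⟨q, hq', hqc⟩ := exists_of_ne_a (hq ▸ hxa)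
    rw [hq', letter_S_add_one] at hq
    have hqx := cyc_injective hq
    have hp : 0 < p := by
      rcases Nat.eq_zero_or_pos p with rfl | hp
      · exfalso
        apply hxa
        rw [← hq, ← letter_S_add_one, ← hq', show j + 0 = S y by omega, letter_S]
      · exact hp
    have hja : letter j = .a := by
      have := h 0 hp
      rw [add_zero, add_zero, hq', add_assoc, ← S_succ_of_ne hqc, letter_S] at this
      exact this
    obtain ⟨j, rfl⟩ := exists_of_eq_a hja
    have hjq : j ≤ q := S_strictMono.le_iff_le.1 (by omega)
    obtain ⟨r, rfl⟩ := Nat.exists_eq_add_of_le hjq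
    obtain ⟨m, rfl⟩ := Nat.exists_eq_add_of_le' hp
    rw [hq', add_assoc, ← S_succ_of_ne hqc] at h
    have h' := (agree_S_iff (by omega : S j + m = S (j + r))).1 h
    have hs := h'.S_add
    have hsq := S_succ_of_ne hqc
    obtain rfl : j + r + r + 1 = y := S_strictMono.injective (by
      rw [add_right_comm (j + r) r 1]; omega)
    refine ⟨j + r, ⟨j, r, rfl, rfl, hqx, ?_, h', ?_⟩, hq'.symm⟩
    · rintro rfl
      exact hy (letter_S_add_one _)
    · rintro i rfl hi
      have hpos : 0 < S (i + 1) := S_strictMono.lt_iff_lt.2 (Nat.succ_pos i)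
      obtain ⟨m, hm⟩ := Nat.exists_eq_add_of_le' hpos
      exact hl m (by omega) (by rw [letter_of_succ_eq_S hm.symm, hi])
  · rintro ⟨q, ⟨j, p, rfl, rfl, hqx, hy, h, hl⟩, rfl⟩
    have hjk' : S j ≤ S (j + p) := S_strictMono.monotone (by omega)
    obtain ⟨q, hq⟩ := Nat.exists_eq_add_of_le hjk'
    have hs := h.S_add
    have hsq := S_succ_of_ne (hqx ▸ hx)
    rw [add_right_comm _ 1 p] at hs
    have h' := (agree_S_iff (k := j + p + 1) hq.symm).2 h
    rw [hsq] at h'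
    refine ⟨S j, q + 1, by simp only; omega, by simp only; omega, ?_, ?_, h', ?_⟩
    · simp only [letter_S_add_one, hqx]
    · rw [letter_S_add_one]
      exact fun h => hy (cyc_injective h)
    · intro m hm heq
      cases j with
      | zero => simp [S_zero] at hm
      | succ i =>
        exact hl i rfl (cyc_injective (by rw [← letter_of_succ_eq_S hm, heq]))

theorem gapped_cyc_S_add_two {x : TLetter} (hx : x ≠ .c) {y : ℕ} (hy : letter y ≠ .c) :
    gapped (cyc x) (S y + 2) = if letter y = x then {S y + 1} else ∅ := by
  have hxa := cyc_ne_a hx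
  have hya : letter (S y + 1) ≠ .a := by
    rw [letter_S_add_one]
    exact cyc_ne_a hy
  have key : ∀ q ∈ gapped (cyc x) (S y + 2), q = S y + 1 ∧ letter y = x := by
    rintro q ⟨j, p, rfl, he, hq, -, h, -⟩
    have hp : p = 0 := by
      by_contra hp
      obtain ⟨m, rfl⟩ := Nat.exists_eq_add_of_le' (Nat.pos_of_ne_zero hp)
      have := h m (by omega)
      rw [show j + (m + 1) + 1 + m = S y + 1 by omega] at this
      apply hya
      rw [← this]
      exact letter_of_succ_ne_a (by rw [← add_assoc] at hq; rw [hq]; exact hxa)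
    subst hp
    have hj : j + 0 = S y + 1 := by omega
    rw [hj, letter_S_add_one] at hq
    exact ⟨hj, cyc_injective hq⟩
  split_ifs with hyx
  · ext q
    rw [Set.mem_singleton_iff]
    refine ⟨fun h => (key q h).1, ?_⟩
    rintro rfl
    refine ⟨S y + 1, 0, rfl, rfl, by rw [letter_S_add_one, hyx], ?_, fun i hi => by omega, ?_⟩
    · rw [← S_succ_of_ne hy, letter_S]
      exact hxa.symm
    · rintro i hi
      rw [show i = S y by omega, letter_S]
      exact hxa.symm
  · ext q
    simp only [Set.mem_empty_iff_false, iff_false]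
    exact fun h => hyx (key q h).2

theorem eq_of_mem_gapped_a {e q : ℕ} (h : q ∈ gapped .a e) : q + 1 = e := by
  obtain ⟨j, p, rfl, rfl, hq, he, h, hl⟩ := h
  rcases Nat.eq_zero_or_pos p with rfl | hp
  · rfl
  obtain ⟨m, rfl⟩ := Nat.exists_eq_add_of_le' hp
  have h₁ := h m (by omega)
  have h₂ : letter (j + (m + 1) + 1 + m) = .a := by
    apply letter_of_succ_ne_a
    convert he using 2
    omega
  rw [h₂] at h₁
  have h₃ := not_three_a h₁ hq
  have h₄ := h 0 hp
  rw [show j + (m + 1) + 1 + 0 = j + m + 2 by omega] at h₄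
  rw [← h₄] at h₃
  exfalso
  cases j with
  | zero => exact h₃ letter_zero
  | succ i => exact hl i rfl (letter_of_succ_ne_a h₃)

open Classical in
theorem gapped_a_S_add_one (y : ℕ) :
    gapped .a (S y + 1) =
      if letter y ≠ .c ∧ ∀ i, i + 1 = y → letter i ≠ .c then {S y} else ∅ := by
  have hiff : letter (S y + 1) ≠ .a ↔ letter y ≠ .c := by
    rw [letter_S_add_one, show TLetter.a = cyc .c from rfl, cyc_injective.ne_iff]
  have hleft : (∀ i, i + 1 = S y → letter i ≠ .a) ↔ ∀ i, i + 1 = y → letter i ≠ .c := by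
    cases y with
    | zero => simp [S_zero]
    | succ z =>
      have hpos : 0 < S (z + 1) := S_strictMono.lt_iff_lt.2 (Nat.succ_pos z)
      obtain ⟨m, hm⟩ := Nat.exists_eq_add_of_le' hpos
      have hz := letter_of_succ_eq_S hm.symm
      rw [hm]
      simp only [Nat.add_right_cancel_iff, forall_eq]
      rw [hz, show TLetter.a = cyc .c from rfl, cyc_injective.ne_iff]
  have key : ∀ q, q ∈ gapped .a (S y + 1) ↔
      q = S y ∧ letter y ≠ .c ∧ ∀ i, i + 1 = y → letter i ≠ .c := by
    intro q
    constructor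
    · intro h
      have hq : q = S y := by have := eq_of_mem_gapped_a h; omega
      obtain ⟨j, p, rfl, he, -, h₁, -, h₂⟩ := h
      obtain rfl : p = 0 := by omega
      rw [add_zero] at hq
      subst hq
      exact ⟨rfl, hiff.1 h₁, hleft.1 h₂⟩
    · rintro ⟨rfl, h₁, h₂⟩
      exact ⟨S y, 0, rfl, rfl, letter_S y, hiff.2 h₁, fun i hi => by omega, hleft.2 h₂⟩
  ext q
  rw [key]
  split_ifs with h
  · exact and_iff_left h
  · exact iff_of_false (fun h' => h h'.2) id

theorem gapped_a_S_add_two {y : ℕ} (hy : letter y ≠ .c) : gapped .a (S y + 2) = ∅ := by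
  ext q
  simp only [Set.mem_empty_iff_false, iff_false]
  intro h
  have hq : q = S y + 1 := by have := eq_of_mem_gapped_a h; omega
  obtain ⟨j, p, -, -, h₁, -⟩ := h
  rw [hq, letter_S_add_one] at h₁
  exact cyc_ne_a hy h₁


/-! ### Counting -/

theorem sum_range_S (f : ℕ → ℕ) (n : ℕ) :
    ∑ i ∈ range (S n), f i =
      ∑ e ∈ range n, (f (S e) + if letter e = .c then 0 else f (S e + 1)) := by
  induction n with
  | zero => simp [S_zero]
  | succ n ih =>
    rw [sum_range_succ, ← ih]
    split_ifs with h
    · rw [S_succ_of_eq h, sum_range_succ, add_zero]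
    · rw [S_succ_of_ne h, sum_range_succ, sum_range_succ, add_assoc]

/-- The sum of `f` over the positions before `n` that carry the letter `x`. -/
def letterSum (x : TLetter) (f : ℕ → ℕ) (n : ℕ) : ℕ :=
  ∑ e ∈ range n, if letter e = x then f e else 0

theorem letterSum_succ (x : TLetter) (f : ℕ → ℕ) (n : ℕ) :
    letterSum x f (n + 1) = letterSum x f n + if letter n = x then f n else 0 :=
  sum_range_succ _ _

theorem sum_eq_letterSum (f : ℕ → ℕ) (n : ℕ) :
    ∑ e ∈ range n, f e = letterSum .a f n + letterSum .b f n + letterSum .c f n := by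
  simp only [letterSum, ← sum_add_distrib]
  refine sum_congr rfl fun e _ => ?_
  cases letter e <;> simp

theorem letterSum_a_S_add_one (f : ℕ → ℕ) (n : ℕ) :
    letterSum .a f (S n + 1) = ∑ e ∈ range (n + 1), f (S e) := by
  rw [letterSum, sum_range_succ, sum_range_succ, sum_range_S, if_pos (letter_S n)]
  congr 1
  refine sum_congr rfl fun e _ => ?_
  by_cases he : letter e = .c
  · simp [he, letter_S]
  · simp [he, letter_S, letter_S_add_one, cyc_ne_a he]

theorem letterSum_cyc_S_add_one {x : TLetter} (hx : x ≠ .c) (f : ℕ → ℕ) (n : ℕ) :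
    letterSum (cyc x) f (S n + 1) = letterSum x (fun e => f (S e + 1)) n := by
  have hxa := cyc_ne_a hx
  rw [letterSum, sum_range_succ, sum_range_S, letter_S, if_neg hxa.symm, add_zero]
  refine sum_congr rfl fun e _ => ?_
  by_cases he : letter e = .c
  · simp [he, letter_S, hxa.symm, hx.symm]
  · simp [he, letter_S, letter_S_add_one, hxa.symm, cyc_injective.eq_iff]

/-- Number of square occurrences in the prefix of length `n`. -/
noncomputable def squareCount (n : ℕ) : ℕ := ∑ e ∈ range (n + 1), (squares e).ncard

/-- Number of maximal repetitions whose first square lies in the prefix of length `n`. -/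
noncomputable def startCount (n : ℕ) : ℕ := ∑ e ∈ range (n + 1), (starting e).ncard

/-- Number of maximal repetitions `wxw` in the prefix of length `n`. -/
noncomputable def gapCount (x : TLetter) (n : ℕ) : ℕ := ∑ e ∈ range (n + 1), (gapped x e).ncard

theorem squareCount_eq (n : ℕ) :
    squareCount n = ∑ e ∈ range n, (extending e).ncard + startCount n := by
  rw [squareCount, startCount, sum_range_succ', sum_range_succ']
  simp [ncard_squares_succ, sum_add_distrib, squares_zero, starting_zero]

theorem letterSum_a_extending (n : ℕ) :
    letterSum .a (fun e => (extending e).ncard) (S n + 1) = squareCount n := by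
  rw [letterSum_a_S_add_one]
  refine sum_congr rfl fun e _ => ?_
  rw [extending_S, Set.ncard_image_of_injective _ S_strictMono.injective]

theorem letterSum_cyc_extending {x : TLetter} (hx : x ≠ .c) (n : ℕ) :
    letterSum (cyc x) (fun e => (extending e).ncard) (S n + 1) =
      letterSum x (fun e => (extending e).ncard) n := by
  rw [letterSum_cyc_S_add_one hx]
  refine sum_congr rfl fun e _ => ?_
  dsimp only
  split_ifs with he
  · rw [extending_S_add_one (he ▸ hx), Set.ncard_image_of_injective]
    exact fun i j h => S_strictMono.injective (Nat.succ_injective h)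
  · rfl

theorem startCount_S_add_one (n : ℕ) :
    startCount (S n + 1) =
      startCount n + gapCount .c n + if letter n = .c then (starting (n + 1)).ncard else 0 := by
  have hS : ∀ e, (starting (S e)).ncard = (starting e).ncard := fun e => by
    rw [starting_S, Set.ncard_image_of_injective _ S_strictMono.injective]
  have hS' : ∀ e, letter e ≠ .c → (starting (S e + 1)).ncard = (gapped .c e).ncard := fun e he => by
    rw [starting_S_add_one he, Set.ncard_image_of_injective]
    exact fun i j h => Nat.succ_injective (S_strictMono.injective h)
  have hsum : ∑ i ∈ range (S n), (starting i).ncard =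
      ∑ e ∈ range n, ((starting e).ncard + (gapped .c e).ncard) := by
    rw [sum_range_S]
    refine sum_congr rfl fun e _ => ?_
    split_ifs with he
    · rw [hS, gapped_of_eq he, Set.ncard_empty]
    · rw [hS, hS' e he]
  rw [startCount, startCount, gapCount, sum_range_succ, sum_range_succ, hsum, sum_add_distrib,
    sum_range_succ, sum_range_succ, hS]
  split_ifs with hn
  · rw [← S_succ_of_eq hn, hS, gapped_of_eq hn, Set.ncard_empty]
    ring
  · rw [hS' n hn]
    ring

theorem gapCount_cyc_S_add_one {x : TLetter} (hx : x ≠ .c) (n : ℕ) :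
    gapCount (cyc x) (S n + 1) = gapCount x n + letterSum x (fun _ => 1) n := by
  have hS : ∀ e, (gapped (cyc x) (S e + 1)).ncard = (gapped x e).ncard := fun e => by
    rw [gapped_cyc_S_add_one hx, Set.ncard_image_of_injective]
    exact fun i j h => S_strictMono.injective (Nat.succ_injective h)
  rw [gapCount, sum_range_succ', gapped_zero, Set.ncard_empty, add_zero, sum_range_succ,
    sum_range_S (fun i => (gapped (cyc x) (i + 1)).ncard), gapCount, sum_range_succ, hS,
    add_right_comm, letterSum, ← sum_add_distrib]
  congr 1
  refine sum_congr rfl fun e _ => ?_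
  rw [hS]
  split_ifs with h₁ h₂ h₂
  · exact absurd (h₂.symm.trans h₁) hx
  · rfl
  · rw [gapped_cyc_S_add_two hx h₁, if_pos h₂, Set.ncard_singleton]
  · rw [gapped_cyc_S_add_two hx h₁, if_neg h₂, Set.ncard_empty]

theorem gapCount_a_S_add_one (n : ℕ) :
    gapCount .a (S n + 1) + 2 * letterSum .c (fun _ => 1) n + (if letter n = .c then 1 else 0) =
      n + 1 := by
  have h : gapCount .a (S n + 1) = ∑ e ∈ range (n + 1), (gapped .a (S e + 1)).ncard := by
    rw [gapCount, sum_range_succ', gapped_zero, Set.ncard_empty, add_zero, sum_range_succ,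
      sum_range_S (fun i => (gapped .a (i + 1)).ncard), sum_range_succ]
    congr 1
    refine sum_congr rfl fun e _ => ?_
    split_ifs with he
    · rfl
    · rw [gapped_a_S_add_two he, Set.ncard_empty, add_zero]
  rw [h]
  clear h
  induction n with
  | zero => simp [gapped_a_S_add_one, letterSum, letter_zero]
  | succ n ih =>
    rw [sum_range_succ, letterSum_succ, gapped_a_S_add_one (n + 1)]
    simp only [Nat.add_right_cancel_iff, forall_eq]
    by_cases hn : letter n = .c
    · have hn' : letter (n + 1) = .a := letter_succ_of_ne_a (by rw [hn]; decide)
      simp only [hn, hn', if_true] at ih ⊢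
      simp
      omega
    · by_cases hn' : letter (n + 1) = .c
      · simp only [hn, hn', if_true, if_false] at ih ⊢
        simp
        omega
      · rw [if_pos ⟨hn', hn⟩, Set.ncard_singleton, if_neg hn, if_neg hn']
        rw [if_neg hn] at ih
        omega

/-! ### The distinguished prefix lengths -/

/-- The lengths `0, 1, 3, 7, 14, …` obtained by iterating `n ↦ S n + 1`. -/
def ell : ℕ → ℕ
  | 0 => 0
  | k + 1 => S (ell k) + 1

theorem letterSum_a_ell (k : ℕ) : letterSum .a (fun _ => 1) (ell (k + 1)) = ell k + 1 := by
  rw [ell, letterSum_a_S_add_one]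
  simp

theorem letterSum_b_ell (k : ℕ) : letterSum .b (fun _ => 1) (ell (k + 2)) = ell k + 1 := by
  rw [ell, show TLetter.b = cyc .a from rfl, letterSum_cyc_S_add_one (by decide), letterSum_a_ell]

theorem letterSum_c_ell (k : ℕ) : letterSum .c (fun _ => 1) (ell (k + 3)) = ell k + 1 := by
  rw [ell, show TLetter.c = cyc .b from rfl, letterSum_cyc_S_add_one (by decide), letterSum_b_ell]

theorem ell_add_three (k : ℕ) : ell (k + 3) = ell (k + 2) + ell (k + 1) + ell k + 3 := by
  have h := sum_eq_letterSum (fun _ => 1) (ell (k + 3))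
  rw [letterSum_a_ell, letterSum_b_ell, letterSum_c_ell] at h
  simp at h
  omega

theorem squareCount_ell (k : ℕ) :
    squareCount (ell (k + 3)) = squareCount (ell (k + 2)) + squareCount (ell (k + 1)) +
      squareCount (ell k) + startCount (ell (k + 3)) := by
  have ha : ∀ k, letterSum .a (fun e => (extending e).ncard) (ell (k + 1)) =
      squareCount (ell k) := fun k => letterSum_a_extending _
  have hb : ∀ k, letterSum .b (fun e => (extending e).ncard) (ell (k + 2)) =
      squareCount (ell k) := fun k =>
    (letterSum_cyc_extending (x := .a) (by decide) _).trans (ha k)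
  have hc : letterSum .c (fun e => (extending e).ncard) (ell (k + 3)) =
      squareCount (ell k) :=
    (letterSum_cyc_extending (x := .b) (by decide) _).trans (hb k)
  rw [squareCount_eq, sum_eq_letterSum, ha, hb, hc]

theorem ncard_starting_ell {k : ℕ} (h : letter (ell (k + 4)) = .c) :
    (starting (ell (k + 4) + 1)).ncard = 1 := by
  have h₃ : letter (ell (k + 3)) = .b :=
    cyc_injective ((letter_S_add_one (ell (k + 3))).symm.trans h)
  have h₂ : letter (ell (k + 2)) = .a :=
    cyc_injective ((letter_S_add_one (ell (k + 2))).symm.trans h₃)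
  have h₁ : letter (ell (k + 1)) = .c :=
    cyc_injective ((letter_S_add_one (ell (k + 1))).symm.trans h₂)
  have h₀ : letter (ell k) = .b :=
    cyc_injective ((letter_S_add_one (ell k)).symm.trans h₁)
  have h₁' : letter (ell (k + 1) + 1) = .a := letter_succ_of_ne_a (by rw [h₁]; decide)
  have e₄ : ell (k + 4) + 1 = S (ell (k + 3) + 1) := (S_succ_of_ne (by rw [h₃]; decide)).symm
  have e₃ : ell (k + 3) + 1 = S (ell (k + 2) + 1) := (S_succ_of_ne (by rw [h₂]; decide)).symm
  have e₂ : ell (k + 2) + 1 = S (ell (k + 1) + 1) + 1 := by rw [S_succ_of_eq h₁]; rfl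
  rw [e₄, starting_S, Set.ncard_image_of_injective _ S_strictMono.injective, e₃, starting_S,
    Set.ncard_image_of_injective _ S_strictMono.injective, e₂,
    starting_S_add_one (by rw [h₁']; decide), Set.ncard_image_of_injective]
  · have := gapped_cyc_S_add_two (x := .b) (by decide) (y := ell k) (by rw [h₀]; decide)
    rw [if_pos h₀] at this
    rw [show ell (k + 1) + 1 = S (ell k) + 2 from rfl, show TLetter.c = cyc .b from rfl, this,
      Set.ncard_singleton]
  · exact fun i j h => Nat.succ_injective (S_strictMono.injective h)

theorem startCount_ell (k : ℕ) :
    startCount (ell (k + 7)) + 2 * (ell k + 1) =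
      startCount (ell (k + 6)) + 3 * (ell (k + 3) + 1) := by
  have h₁ : startCount (ell (k + 7)) = startCount (ell (k + 6)) + gapCount .c (ell (k + 6)) +
      if letter (ell (k + 6)) = .c then (starting (ell (k + 6) + 1)).ncard else 0 :=
    startCount_S_add_one _
  have h₂ : gapCount .c (ell (k + 6)) = gapCount .b (ell (k + 5)) +
      letterSum .b (fun _ => 1) (ell (k + 5)) := gapCount_cyc_S_add_one (x := .b) (by decide) _
  have h₃ : gapCount .b (ell (k + 5)) = gapCount .a (ell (k + 4)) +
      letterSum .a (fun _ => 1) (ell (k + 4)) := gapCount_cyc_S_add_one (x := .a) (by decide) _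
  have h₄ : gapCount .a (ell (k + 4)) + 2 * letterSum .c (fun _ => 1) (ell (k + 3)) +
      (if letter (ell (k + 3)) = .c then 1 else 0) = ell (k + 3) + 1 := gapCount_a_S_add_one _
  rw [letterSum_b_ell] at h₂
  rw [letterSum_a_ell] at h₃
  rw [letterSum_c_ell] at h₄
  have hiff : letter (ell (k + 6)) = .c ↔ letter (ell (k + 3)) = .c := by
    have : letter (ell (k + 6)) = cyc (cyc (cyc (letter (ell (k + 3))))) := by
      rw [ell, letter_S_add_one, ell, letter_S_add_one, ell, letter_S_add_one]
    rw [this]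
    cases letter (ell (k + 3)) <;> simp [cyc]
  by_cases hc : letter (ell (k + 6)) = .c
  · rw [if_pos hc, ncard_starting_ell hc] at h₁
    rw [if_pos (hiff.1 hc)] at h₄
    omega
  · rw [if_neg hc] at h₁
    rw [if_neg (hiff.not.1 hc)] at h₄
    omega

theorem two_mul_ell_add_three (k : ℕ) : 2 * ell k + 3 = tribAux (k + 3) + tribAux (k + 1) := by
  induction k using Nat.strong_induction_on with
  | _ k ih =>
    match k with
    | 0 => simp [ell, tribAux]
    | 1 => simp [ell, S_zero, tribAux]
    | 2 =>
      have : S 1 = 2 := by rw [S_succ_of_ne (by rw [letter_zero]; decide), S_zero]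
      simp [ell, S_zero, tribAux, this]
    | k + 3 =>
      have h₀ := ih k (by omega)
      have h₁ := ih (k + 1) (by omega)
      have h₂ := ih (k + 2) (by omega)
      have h₃ := ell_add_three k
      have h₄ : tribAux (k + 6) = tribAux (k + 5) + tribAux (k + 4) + tribAux (k + 3) := rfl
      have h₅ : tribAux (k + 4) = tribAux (k + 3) + tribAux (k + 2) + tribAux (k + 1) := rfl
      simp only [Nat.reduceAdd, add_assoc] at *
      omega

/-! ### Squares as pairs of a word and a position -/

theorem map_range'_eq_iff {j k p : ℕ} :
    (List.range' j p).map letter = (List.range' k p).map letter ↔ Agree j k p := by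
  constructor
  · intro h i hi
    have := congrArg (fun l => l[i]?) h
    simpa [hi] using this
  · intro h
    apply List.ext_getElem
    · simp
    · intro i h₁ h₂
      simpa using h i (by simpa using h₁)

theorem append_self_prefix_iff {w : List TLetter} {j n : ℕ} (h : j + 2 * w.length ≤ n) :
    (w ++ w) <+: (TPrefix n).drop j ↔
      w = (List.range' j w.length).map letter ∧ Agree j (j + w.length) w.length := by
  have htake : ((TPrefix n).drop j).take (w ++ w).length =
      (List.range' j w.length).map letter ++
        (List.range' (j + w.length) w.length).map letter := by
    rw [TPrefix_eq, ← List.map_append, List.range'_append_1, ← List.map_drop, ← List.map_take,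
      List.range_eq_range', List.drop_range',
      List.take_range'_of_length_ge (k := (w ++ w).length) (by simp; omega)]
    simp
  rw [List.prefix_iff_eq_take, htake, ← map_range'_eq_iff]
  constructor
  · intro h
    obtain ⟨h₁, h₂⟩ := List.append_inj h (by simp)
    exact ⟨h₁, h₁.symm.trans h₂⟩
  · rintro ⟨h₁, h₂⟩
    rw [← h₂, ← h₁]

theorem B_eq_squareCount (n : ℕ) : B n = squareCount n := by
  have hfin : ∀ e : Fin (n + 1), Finite (squares e) := fun e => (squares_finite e).to_subtype
  have hsum : squareCount n = Nat.card (Σ e : Fin (n + 1), squares e) := by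
    rw [Nat.card_sigma, squareCount, ← Fin.sum_univ_eq_sum_range (fun e => (squares e).ncard)]
    rfl
  rw [hsum, B]
  symm
  have hmem : ∀ x : Σ e : Fin (n + 1), squares e,
      ∃ j p, 0 < p ∧ x.2.1 = j + p ∧ x.1.1 = j + p + p ∧ Agree j (j + p) p := by
    rintro ⟨e, k, j, p, hp, hk, he, h⟩
    subst hk
    exact ⟨j, p, hp, rfl, he.symm, h⟩
  refine Nat.card_eq_of_bijective (fun x => ⟨((List.range' x.2.1 (x.1.1 - x.2.1)).map letter,
    2 * x.2.1 - x.1.1 + 1), ?_⟩) ⟨?_, ?_⟩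
  · obtain ⟨j, p, hp, hk, he, h⟩ := hmem x
    have hn := x.1.2
    rw [hk, he, show j + p + p - (j + p) = p by omega,
      show 2 * (j + p) - (j + p + p) + 1 = j + 1 by omega]
    refine ⟨by simp; omega, by simp, by simp; omega, ?_⟩
    rw [Nat.add_sub_cancel, append_self_prefix_iff (by simp; omega)]
    simpa [map_range'_eq_iff] using ⟨fun i hi => (h i hi).symm, h⟩
  · intro x y hxy
    obtain ⟨j, p, hp, hk, he, h⟩ := hmem x
    obtain ⟨j', p', hp', hk', he', h'⟩ := hmem y
    simp only [Subtype.mk.injEq, Prod.mk.injEq] at hxy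
    have hlen := congrArg List.length hxy.1
    have hpos := hxy.2
    simp only [List.length_map, List.length_range'] at hlen
    obtain ⟨⟨e, hlt⟩, k, hx⟩ := x
    obtain ⟨⟨e', hlt'⟩, k', hy⟩ := y
    simp only at hk hk' he he' hlen hpos
    obtain rfl : e = e' := by omega
    obtain rfl : k = k' := by omega
    rfl
  · rintro ⟨⟨w, i⟩, hw, hi, hin, hpre⟩
    simp only at hw hi hin hpre
    have hlen := List.length_pos_iff.2 hw
    obtain ⟨j, rfl⟩ := Nat.exists_eq_add_of_le' hi
    rw [Nat.add_sub_cancel, append_self_prefix_iff (by omega)] at hpre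
    refine ⟨⟨⟨j + w.length + w.length, by omega⟩, ⟨j + w.length,
      ⟨j, w.length, hlen, rfl, rfl, hpre.2⟩⟩⟩, ?_⟩
    simp only [Subtype.mk.injEq, Prod.mk.injEq]
    refine ⟨?_, by omega⟩
    rw [Nat.add_sub_cancel_left, map_range'_eq_iff.2 fun i hi => (hpre.2 i hi).symm]
    exact hpre.1.symm

theorem t_natCast (k : ℕ) : t k = tribAux (k + 2) := by
  rw [t]
  congr 1

theorem Phi_natCast (k : ℕ) :
    Phi ((k + 2 : ℕ) : ℤ) =
      (squareCount (ell (k + 2)) : ℚ) - (squareCount (ell (k + 1)) : ℚ) := by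
  have h₁ := two_mul_ell_add_three (k + 1)
  have h₂ := two_mul_ell_add_three (k + 2)
  have h₃ : tribAux (k + 5) = tribAux (k + 4) + tribAux (k + 3) + tribAux (k + 2) := rfl
  rw [Phi, show ((k + 2 : ℕ) : ℤ) - 1 = ((k + 1 : ℕ) : ℤ) by push_cast; ring,
    show ((k + 2 : ℕ) : ℤ) - 2 = (k : ℤ) by push_cast; ring, t_natCast, t_natCast, t_natCast,
    B_eq_squareCount, B_eq_squareCount]
  simp only [add_assoc, Nat.reduceAdd] at *
  congr 3 <;> omega

end TribonacciWord

open TribonacciWord in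
theorem Phi_recurrence (m : ℤ) (hm : 7 ≤ m) :
    Phi m = Phi (m - 1) + Phi (m - 2) + Phi (m - 3) +
      (-3 * (t m : ℚ) + 6 * (t (m - 1) : ℚ) + (t (m - 2) : ℚ) - 1) / 2 := by
  obtain ⟨k, rfl⟩ : ∃ k : ℕ, m = ((k + 7 : ℕ) : ℤ) := ⟨(m - 7).toNat, by omega⟩
  rw [show ((k + 7 : ℕ) : ℤ) - 1 = ((k + 6 : ℕ) : ℤ) by push_cast; ring,
    show ((k + 7 : ℕ) : ℤ) - 2 = ((k + 5 : ℕ) : ℤ) by push_cast; ring,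
    show ((k + 7 : ℕ) : ℤ) - 3 = ((k + 4 : ℕ) : ℤ) by push_cast; ring,
    t_natCast, t_natCast, t_natCast,
    Phi_natCast (k + 5), Phi_natCast (k + 4), Phi_natCast (k + 3), Phi_natCast (k + 2)]
  have h₁ : (_ : ℚ) = _ := congrArg Nat.cast (squareCount_ell (k + 4))
  have h₂ : (_ : ℚ) = _ := congrArg Nat.cast (squareCount_ell (k + 3))
  have h₃ : (_ : ℚ) = _ := congrArg Nat.cast (startCount_ell k)
  have e₀ : (_ : ℚ) = _ := congrArg Nat.cast (two_mul_ell_add_three k)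
  have e₃ : (_ : ℚ) = _ := congrArg Nat.cast (two_mul_ell_add_three (k + 3))
  have htrib : ∀ i, (tribAux (i + 3) : ℚ) = tribAux (i + 2) + tribAux (i + 1) + tribAux i :=
    fun i => by exact_mod_cast (rfl : tribAux (i + 3) = _)
  have t₉ := htrib (k + 6)
  have t₈ := htrib (k + 5)
  have t₇ := htrib (k + 4)
  have t₆ := htrib (k + 3)
  have t₅ := htrib (k + 2)
  have t₄ := htrib (k + 1)
  push_cast at h₁ h₂ h₃ e₀ e₃
  simp only [add_assoc, Nat.reduceAdd] at *
  linarith
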